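/- Let 𝒥 be a proper constrained level graph of height 3 without isolated vertices and let Γ be a constrained level planar drawing of 𝒥. If 𝒥 has two connected components C and C′ such that C′ hooks into C from the right in Γ, then the following hold: (1) the hook piece of C towards C′ and the hook piece of C′ towards C each have vertices on exactly two levels and are caterpillars; (2) each of these hook pieces contains exactly one vertex that has a neighbor outside of it; (3) all neighbors of the hook vertices of C towards C′ lie on a common level, and all neighbors of the hook vertices of C′ towards C lie on a common level; (4) if the neighbors of the hook vertices of C towards C′ lie on the top level, then the neighbors of the hook vertices of C′ towards C lie on the bottom level, and vice versa. -/

import Mathlib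

open scoped Classical

/-- A constrained level graph: a finite directed graph with a surjective level
assignment `lvl : V → {1, …, h}` such that edges go strictly upwards, together
with a partial order `≺ᵢ` on each level. -/
structure ConstrainedLevelGraph (V : Type) [Fintype V] where
  h : ℕ
  Edge : V → V → Prop
  lvl : V → ℕ
  lvl_one_le : ∀ v, 1 ≤ lvl v
  lvl_le : ∀ v, lvl v ≤ h
  lvl_surj : ∀ i, 1 ≤ i → i ≤ h → ∃ v, lvl v = i
  edge_lt : ∀ u v, Edge u v → lvl u < lvl v
  prec : ℕ → V → V → Prop
  prec_lvl : ∀ i u v, prec i u v → lvl u = i ∧ lvl v = i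
  prec_irrefl : ∀ i v, ¬ prec i v v
  prec_trans : ∀ i a b c, prec i a b → prec i b c → prec i a c

/-- A constrained level planar drawing. -/
structure CLPDrawing {V : Type} [Fintype V] (G : ConstrainedLevelGraph V) where
  x : V → ℝ
  f : V → V → ℝ → ℝ
  x_inj : ∀ u v, G.lvl u = G.lvl v → x u = x v → u = v
  f_cont : ∀ u v, G.Edge u v → ContinuousOn (f u v) (Set.Icc (G.lvl u : ℝ) (G.lvl v : ℝ))
  f_src : ∀ u v, G.Edge u v → f u v (G.lvl u : ℝ) = x u
  f_tgt : ∀ u v, G.Edge u v → f u v (G.lvl v : ℝ) = x v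
  planar : ∀ u v u' v', G.Edge u v → G.Edge u' v' → (u, v) ≠ (u', v') →
    ∀ t : ℝ, t ∈ Set.Icc (G.lvl u : ℝ) (G.lvl v : ℝ) →
      t ∈ Set.Icc (G.lvl u' : ℝ) (G.lvl v' : ℝ) → f u v t = f u' v' t →
      ∃ w, (w = u ∨ w = v) ∧ (w = u' ∨ w = v') ∧ t = (G.lvl w : ℝ) ∧ f u v t = x w
  no_through : ∀ u v w, G.Edge u v → w ≠ u → w ≠ v →
    G.lvl u ≤ G.lvl w → G.lvl w ≤ G.lvl v → f u v (G.lvl w : ℝ) ≠ x w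
  prec_ok : ∀ i u v, G.prec i u v → x u < x v

variable {V : Type} [Fintype V]

/-- Undirected adjacency. -/
def Adj (G : ConstrainedLevelGraph V) (u v : V) : Prop :=
  G.Edge u v ∨ G.Edge v u

/-- Undirected reachability (being in the same connected component). -/
def Reach (G : ConstrainedLevelGraph V) : V → V → Prop :=
  Relation.ReflTransGen (Adj G)

/-- The span of a vertex set `X` in the drawing `D`: the set of middle-level
(level 2) vertices lying in the smallest interval (with respect to the
x-coordinates) containing all middle-level vertices of `X`. -/
def SpanSet (G : ConstrainedLevelGraph V) (D : CLPDrawing G) (X : Set V) : Set V :=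
  {w | G.lvl w = 2 ∧ ∃ u ∈ X, ∃ v ∈ X, G.lvl u = 2 ∧ G.lvl v = 2 ∧
        D.x u ≤ D.x w ∧ D.x w ≤ D.x v}

/-- `B` hooks into `A` from the right in the drawing `D`. -/
def HooksRight (G : ConstrainedLevelGraph V) (D : CLPDrawing G) (A B : Set V) : Prop :=
  ∃ u v u' v', u ∈ A ∧ v ∈ A ∧ u' ∈ B ∧ v' ∈ B ∧ u ≠ v ∧ u' ≠ v' ∧
    G.lvl u = 2 ∧ G.lvl v = 2 ∧ G.lvl u' = 2 ∧ G.lvl v' = 2 ∧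
    D.x u < D.x u' ∧ D.x u' < D.x v ∧ D.x v < D.x v' ∧
    (∀ w ∈ A ∪ B, G.lvl w = 2 → D.x u ≤ D.x w) ∧
    (∀ w ∈ A ∪ B, G.lvl w = 2 → D.x w ≤ D.x v')

/-- The hook vertices of `A` towards `B`: the middle-level vertices of `A`
inside the span of `B`. -/
def HookVerts (G : ConstrainedLevelGraph V) (D : CLPDrawing G) (A B : Set V) : Set V :=
  {w | w ∈ A ∧ w ∈ SpanSet G D B}

/-- The hook piece of `A` towards `B`: the closed neighborhood of the hook
vertices of `A` towards `B` (the vertex set of the subgraph induced by it). -/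
def HookPiece (G : ConstrainedLevelGraph V) (D : CLPDrawing G) (A B : Set V) : Set V :=
  HookVerts G D A B ∪ {z | ∃ w ∈ HookVerts G D A B, Adj G w z}

/-- The graph induced by `G` on the vertex set `W` (as an undirected simple graph). -/
def inducedSG (G : ConstrainedLevelGraph V) (W : Set V) : SimpleGraph W :=
  SimpleGraph.fromRel fun u v => G.Edge u.1 v.1

/-- A caterpillar: a tree in which every vertex is within distance at most one
of a central path. -/
def IsCaterpillar {α : Type} (H : SimpleGraph α) : Prop :=
  H.Connected ∧ H.IsAcyclic ∧
    ∃ p : List α, p ≠ [] ∧ p.Chain' H.Adj ∧ p.Nodup ∧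
      ∀ v : α, v ∈ p ∨ ∃ w ∈ p, H.Adj v w

/-- The vertex set `W` occupies exactly two levels. -/
def TwoLevels (G : ConstrainedLevelGraph V) (W : Set V) : Prop :=
  ∃ i j, i ≠ j ∧ (∃ v ∈ W, G.lvl v = i) ∧ (∃ v ∈ W, G.lvl v = j) ∧
    ∀ v ∈ W, G.lvl v = i ∨ G.lvl v = j

namespace SimpleGraph

/-- A straight-line two-layer drawing of `H`, with layers `mid` and its complement ordered by
`x`, has no crossings. -/
structure TwoLayerNoncrossing {α : Type} (H : SimpleGraph α) (mid : α → Prop) (x : α → ℝ) :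
    Prop where
  bipartite : ∀ u v, H.Adj u v → (mid u ↔ ¬ mid v)
  inj : ∀ u v, (mid u ↔ mid v) → x u = x v → u = v
  noncrossing : ∀ m m' t t', mid m → mid m' → H.Adj m t → H.Adj m' t' → x m < x m' → x t ≤ x t'

variable {α : Type} {H : SimpleGraph α} {mid : α → Prop} {x : α → ℝ}

theorem TwoLayerNoncrossing.isAcyclic (h : H.TwoLayerNoncrossing mid x) : H.IsAcyclic := by
  intro v c hc
  have two : ∀ w ∈ c.support, ∀ y, ∃ z, z ≠ y ∧ c.toSubgraph.Adj w z := by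
    intro w hw y
    have h2 := hc.ncard_neighborSet_toSubgraph_eq_two hw
    obtain ⟨z, hz, hzy⟩ := Set.exists_ne_of_one_lt_ncard (h2 ▸ one_lt_two) y
    exact ⟨z, hzy, hz⟩
  have hmid : ∃ w ∈ c.support, mid w := by
    by_cases hv : mid v
    · exact ⟨v, c.start_mem_support, hv⟩
    · obtain ⟨z, -, hz⟩ := two v c.start_mem_support v
      have := h.bipartite _ _ hz.adj_sub
      exact ⟨z, c.mem_support_of_adj_toSubgraph hz.symm, by tauto⟩
  obtain ⟨m, hm, hmin⟩ := (c.support.toFinset.filter mid).exists_min_image x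
    (by obtain ⟨w, hw, hw'⟩ := hmid; exact ⟨w, by simp [hw, hw']⟩)
  simp only [Finset.mem_filter, List.mem_toFinset] at hm hmin
  have key : ∀ t t', c.toSubgraph.Adj m t → c.toSubgraph.Adj m t' → ¬ x t < x t' := by
    intro t t' ht ht' hlt
    obtain ⟨m', hne, hm'⟩ := two t (c.mem_support_of_adj_toSubgraph ht.symm) m
    have hb := h.bipartite _ _ ht.adj_sub
    have hb' := h.bipartite _ _ hm'.adj_sub
    have hmm' : mid m' := by tauto
    have hle := hmin m' ⟨c.mem_support_of_adj_toSubgraph hm'.symm, hmm'⟩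
    have hlt' : x m < x m' := hle.lt_of_ne fun he => hne (h.inj _ _ (by tauto) he).symm
    exact hlt.not_ge (h.noncrossing m m' t' t hm.2 hmm' ht'.adj_sub hm'.adj_sub.symm hlt')
  obtain ⟨t, -, ht⟩ := two m hm.1 m
  obtain ⟨t', hne, ht'⟩ := two m hm.1 t
  have hb := h.bipartite _ _ ht.adj_sub
  have hb' := h.bipartite _ _ ht'.adj_sub
  rcases lt_trichotomy (x t) (x t') with hlt | heq | hlt
  · exact key _ _ ht ht' hlt
  · exact hne (h.inj _ _ (by tauto) heq).symm
  · exact key _ _ ht' ht hlt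

/-- A path from the leftmost vertex of one layer to the rightmost vertex of the other is a spine. -/
theorem TwoLayerNoncrossing.isCaterpillar [Finite α] [Nontrivial α]
    (h : H.TwoLayerNoncrossing mid x) (hconn : H.Connected) : IsCaterpillar H := by
  have hnb : ∀ v, ∃ w, H.Adj v w := fun v =>
    hconn.preconnected.exists_adj_of_nontrivial v
  have hedge : ∀ v, ∃ m t, mid m ∧ ¬ mid t ∧ H.Adj m t ∧ (v = m ∨ v = t) := by
    intro v
    obtain ⟨w, hw⟩ := hnb v
    have hb := h.bipartite _ _ hw
    by_cases hv : mid v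
    · exact ⟨v, w, hv, by tauto, hw, Or.inl rfl⟩
    · exact ⟨w, v, by tauto, hv, hw.symm, Or.inr rfl⟩
  obtain ⟨v₀⟩ := hconn.nonempty
  obtain ⟨m₀, t₀, hm₀, ht₀, -, -⟩ := hedge v₀
  obtain ⟨m, hm, hmin⟩ := Set.exists_min_image {v | mid v} x (Set.toFinite _) ⟨m₀, hm₀⟩
  obtain ⟨t, ht, hmax⟩ := Set.exists_max_image {v | ¬ mid v} x (Set.toFinite _) ⟨t₀, ht₀⟩
  obtain ⟨p, hp⟩ := hconn.exists_isPath m t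
  refine ⟨hconn, h.isAcyclic, p.support, p.support_ne_nil, p.isChain_adj_support,
    hp.support_nodup, fun v => ?_⟩
  by_contra! hv
  obtain ⟨hvp, hadj⟩ := hv
  obtain ⟨m', t', hm', ht', hmt, hvv⟩ := hedge v
  have hm'p : m' ∉ p.support := by
    rcases hvv with rfl | rfl
    · exact hvp
    · exact fun hc => hadj _ hc hmt.symm
  have ht'p : t' ∉ p.support := by
    rcases hvv with rfl | rfl
    · exact fun hc => hadj _ hc hmt
    · exact hvp
  have left : ∀ (a b : α) (q : H.Walk a b), m' ∉ q.support → t' ∉ q.support →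
      (mid a → x a < x m') → (¬ mid a → x a < x t') → ¬ mid b → x b < x t' := by
    intro a b q
    induction q with
    | nil => exact fun _ _ _ h2 h3 => h2 h3
    | @cons a c b hac q ih =>
      intro h1 h2 h3 h4
      simp only [Walk.support_cons, List.mem_cons, not_or] at h1 h2
      have hb := h.bipartite _ _ hac
      have hcm : c ≠ m' := fun e => h1.2 (e ▸ q.start_mem_support)
      have hct : c ≠ t' := fun e => h2.2 (e ▸ q.start_mem_support)
      refine ih h1.2 h2.2 (fun hc => ?_) (fun hc => ?_)
      · have ha : ¬ mid a := by tauto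
        by_contra! hle
        have hlt := hle.lt_of_ne fun e => hcm (h.inj _ _ (by tauto) e.symm)
        exact (h4 ha).not_ge (h.noncrossing _ _ _ _ hm' hc hmt hac.symm hlt)
      · have ha : mid a := by tauto
        exact (h.noncrossing _ _ _ _ ha hm' hac hmt (h3 ha)).lt_of_ne
          fun e => hct (h.inj _ _ (by tauto) e)
  have hlt := left m t p hm'p ht'p
    (fun _ => (hmin m' hm').lt_of_ne fun e => hm'p
      (h.inj _ _ (iff_of_true hm hm') e ▸ p.start_mem_support))
    (fun hn => absurd hm hn) ht
  exact hlt.not_ge (hmax t' ht')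

end SimpleGraph

theorem Adj.symm {G : ConstrainedLevelGraph V} {u v : V} (h : Adj G u v) : Adj G v u :=
  Or.symm h

theorem Reach.symm {G : ConstrainedLevelGraph V} {u v : V} (h : Reach G u v) : Reach G v u := by
  induction h with
  | refl => exact .refl
  | tail _ hab ih => exact ih.head hab.symm

/-- The order of each level by `x` is a level planar embedding of a proper level graph of
height 3. -/
structure ThreeLevelPlanar (G : ConstrainedLevelGraph V) (x : V → ℝ) : Prop where
  lvl_nbr_mid : ∀ u v, G.lvl u = 2 → Adj G u v → G.lvl v = 1 ∨ G.lvl v = 3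
  lvl_nbr_outer : ∀ u v, G.lvl u ≠ 2 → Adj G u v → G.lvl v = 2
  inj : ∀ u v, G.lvl u = G.lvl v → x u = x v → u = v
  noncrossing : ∀ m m' t t', G.lvl m = 2 → G.lvl m' = 2 → G.lvl t = G.lvl t' →
    Adj G m t → Adj G m' t' → x m < x m' → x t ≤ x t'

theorem CLPDrawing.le_of_lt {G : ConstrainedLevelGraph V} (D : CLPDrawing G) {u v u' v' : V}
    (h : G.Edge u v) (h' : G.Edge u' v') (hu : G.lvl u = G.lvl u') (hv : G.lvl v = G.lvl v')
    (hlt : D.x u < D.x u') : D.x v ≤ D.x v' := by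
  by_contra! hgt
  have hle : (G.lvl u : ℝ) ≤ G.lvl v := by exact_mod_cast (G.edge_lt _ _ h).le
  have hc' := D.f_cont _ _ h'
  have hs' := D.f_src _ _ h'
  have ht' := D.f_tgt _ _ h'
  rw [← hu] at hs'
  rw [← hv] at ht'
  rw [← hu, ← hv] at hc'
  obtain ⟨t, ht, h0⟩ := intermediate_value_Icc hle ((D.f_cont _ _ h).sub hc')
    (show (0 : ℝ) ∈ _ by
      simp only [Set.mem_Icc, Pi.sub_apply, D.f_src _ _ h, D.f_tgt _ _ h, hs', ht']
      constructor <;> linarith)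
  have hne : (u, v) ≠ (u', v') := by
    rintro ⟨⟩
    exact lt_irrefl _ hlt
  obtain ⟨w, hw, hw', -, -⟩ := D.planar u v u' v' h h' hne t ht (by rwa [← hu, ← hv])
    (sub_eq_zero.mp h0)
  have e1 := G.edge_lt _ _ h
  have e2 := G.edge_lt _ _ h'
  rcases hw with rfl | rfl <;> rcases hw' with rfl | rfl
  · exact lt_irrefl _ hlt
  · omega
  · omega
  · exact lt_irrefl _ hgt

theorem CLPDrawing.threeLevelPlanar {G : ConstrainedLevelGraph V} (D : CLPDrawing G)
    (hh : G.h = 3) (hproper : ∀ u v, G.Edge u v → G.lvl v = G.lvl u + 1) :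
    ThreeLevelPlanar G D.x where
  lvl_nbr_mid u v hu h := by
    rcases h with h | h <;> have := hproper _ _ h <;> omega
  lvl_nbr_outer u v hu h := by
    have h1 := G.lvl_one_le u
    have h2 := G.lvl_le u
    have h3 := G.lvl_one_le v
    have h4 := G.lvl_le v
    rcases h with h | h <;> have := hproper _ _ h <;> omega
  inj := D.x_inj
  noncrossing m m' t t' hm hm' htt h h' hlt := by
    rcases h with h | h <;> rcases h' with h' | h'
    · exact D.le_of_lt h h' (hm.trans hm'.symm) htt hlt
    · have := hproper _ _ h
      have := hproper _ _ h'
      omega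
    · have := hproper _ _ h
      have := hproper _ _ h'
      omega
    · by_contra! hgt
      exact hlt.not_ge (D.le_of_lt h' h htt.symm (hm'.trans hm.symm) hgt)

namespace ThreeLevelPlanar

variable {G : ConstrainedLevelGraph V} {x : V → ℝ}

theorem neg (hP : ThreeLevelPlanar G x) : ThreeLevelPlanar G (fun v => - x v) where
  lvl_nbr_mid := hP.lvl_nbr_mid
  lvl_nbr_outer := hP.lvl_nbr_outer
  inj u v h e := hP.inj u v h (neg_injective e)
  noncrossing m m' t t' hm hm' htt h h' hlt :=
    neg_le_neg (hP.noncrossing m' m t' t hm' hm htt.symm h' h (neg_lt_neg_iff.mp hlt))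

/-- A connected subgraph with middle vertices on both sides of the position `ρ` has a vertex with
neighbors on both sides of `ρ`. -/
theorem exists_bridging (hP : ThreeLevelPlanar G x) {q m : V} {ρ : ℝ} (hr : Reach G q m)
    (hq : G.lvl q = 2) (hm : G.lvl m = 2) (hqρ : x q < ρ) (hρm : ρ < x m)
    (hne : ∀ w, Reach G q w → G.lvl w = 2 → x w ≠ ρ) :
    ∃ c w d, Reach G q c ∧ Adj G c w ∧ Adj G w d ∧ G.lvl c = 2 ∧ G.lvl d = 2 ∧
      x c < ρ ∧ ρ < x d := by
  by_contra! hno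
  have key : ∀ v, Reach G q v → (G.lvl v = 2 → x v < ρ) ∧
      (G.lvl v ≠ 2 → ∀ n, Adj G v n → x n < ρ) := by
    intro v hv
    induction hv with
    | refl => exact ⟨fun _ => hqρ, fun h => absurd hq h⟩
    | @tail v w hv hvw ih =>
      refine ⟨fun hw => ?_, fun hw n hn => ?_⟩
      · refine ih.2 (fun hv2 => ?_) w hvw
        have := hP.lvl_nbr_mid v w hv2 hvw
        omega
      · have hv2 := hP.lvl_nbr_outer w v hw hvw.symm
        have hn2 := hP.lvl_nbr_outer w n hw hn
        exact (hno v w n hv hvw hn hv2 hn2 (ih.1 hv2)).lt_of_ne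
          (hne n ((hv.tail hvw).tail hn) hn2)
  exact hρm.not_gt ((key m hr).1 hm)

/-- If two components alternate on the middle level as `l`, `q`, `r`, `m`, then the inner
vertices `q` and `r` do not have neighbors on the same level. -/
theorem lvl_ne_of_alternating (hP : ThreeLevelPlanar G x) {l q r m t t' : V}
    (hl : G.lvl l = 2) (hq : G.lvl q = 2) (hr : G.lvl r = 2) (hm : G.lvl m = 2)
    (hlr : Reach G l r) (hqm : Reach G q m) (hlq : ¬ Reach G l q)
    (h1 : x l < x q) (h2 : x q < x r) (h3 : x r < x m)
    (hqt : Adj G q t) (hrt : Adj G r t') : G.lvl t ≠ G.lvl t' := by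
  intro htt
  obtain ⟨n, hn⟩ : ∃ n, n = (Finset.univ.filter fun v => x q < x v ∧ x v < x r).card := ⟨_, rfl⟩
  induction n using Nat.strong_induction_on generalizing l q r m t t' with
  | _ n ih =>
  obtain ⟨e, w', f, hle, hew, hwf, he, hf, hxe, hxf⟩ := hP.exists_bridging hlr hl hr h1 h2
    (fun w hw hw2 h => hlq (hP.inj w q (hw2.trans hq.symm) h ▸ hw))
  obtain ⟨c, w, d, hqc, hcw, hwd, hc, hd, hxc, hxd⟩ := hP.exists_bridging hqm hq hm h2 h3
    (fun w hw hw2 h => hlq (hlr.trans (hP.inj w r (hw2.trans hr.symm) h ▸ hw).symm))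
  have hlw' : Reach G l w' := hle.tail hew
  have hqw : Reach G q w := hqc.tail hcw
  have hlf : Reach G l f := hlw'.tail hwf
  have disj : ∀ {y z}, Reach G l y → Reach G q z → G.lvl y = G.lvl z → x y ≠ x z :=
    fun hy hz hyz he => hlq (hy.trans (hP.inj _ _ hyz he ▸ hz).symm)
  have hs' : G.lvl w' ≠ G.lvl t := fun hs =>
    disj hlw' (Relation.ReflTransGen.single hqt) hs
      ((hP.noncrossing e q w' t he hq hs hew hqt hxe).antisymm
        (hP.noncrossing q f t w' hq hf hs.symm hqt hwf.symm hxf))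
  have hs : G.lvl t' ≠ G.lvl w := fun hs =>
    disj (hlr.tail hrt) hqw hs
      ((hP.noncrossing r d t' w hr hd hs hrt hwd.symm hxd).antisymm
        (hP.noncrossing c r w t' hc hr hs.symm hcw hrt hxc))
  have hww : G.lvl w' = G.lvl w := by
    have := hP.lvl_nbr_mid _ _ he hew
    have := hP.lvl_nbr_mid _ _ hc hcw
    have := hP.lvl_nbr_mid _ _ hq hqt
    have := hP.lvl_nbr_mid _ _ hr hrt
    omega
  have hle' := hP.noncrossing e d w' w he hd hww hew hwd.symm (by linarith)
  have hfc : x f < x c := by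
    refine lt_of_le_of_ne ?_ (disj hlf hqc (hf.trans hc.symm))
    by_contra! hcf
    exact disj hlw' hqw hww
      (hle'.antisymm (hP.noncrossing c f w w' hc hf hww.symm hcw hwf.symm hcf))
  refine ih _ ?_ hq hf hc hr hqc (hlf.symm.trans hlr) (fun h => hlq (hlf.trans h.symm))
    hxf hfc hxc hwf.symm hcw hww rfl
  rw [hn]
  apply Finset.card_lt_card
  rw [Finset.ssubset_iff_of_subset]
  · exact ⟨f, by simpa using ⟨hxf, hfc.trans hxc⟩, by simp⟩
  · intro v
    simp only [Finset.mem_filter, Finset.mem_univ, true_and]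
    exact fun hv => ⟨hxf.trans hv.1, hv.2.trans hxc⟩

/-- The middle vertices of a component to the right of a position `β`, if all their neighbors lie
on one level, form with these neighbors a caterpillar attached to the rest of the component at a
single vertex. -/
theorem caterpillar_right_of (hP : ThreeLevelPlanar G x) (hiso : ∀ v : V, ∃ u, Adj G v u)
    {a p h₀ : V} {β : ℝ} {s : ℕ} {W₀ : Set V}
    (hW₀ : ∀ w, w ∈ W₀ ↔ Reach G a w ∧ G.lvl w = 2 ∧ β < x w)
    (hs : ∀ w ∈ W₀, ∀ z, Adj G w z → G.lvl z = s)
    (hap : Reach G a p) (hp : G.lvl p = 2) (hpβ : x p < β) (hh₀ : h₀ ∈ W₀)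
    (hβ : ∀ w, Reach G a w → G.lvl w = 2 → x w ≠ β) :
    TwoLevels G (W₀ ∪ {z | ∃ w ∈ W₀, Adj G w z}) ∧
    IsCaterpillar (inducedSG G (W₀ ∪ {z | ∃ w ∈ W₀, Adj G w z})) ∧
    ∃! w, w ∈ W₀ ∪ {z | ∃ w ∈ W₀, Adj G w z} ∧
      ∃ z, z ∉ W₀ ∪ {z | ∃ w ∈ W₀, Adj G w z} ∧ Adj G w z := by
  set W : Set V := W₀ ∪ {z | ∃ w ∈ W₀, Adj G w z}
  have hlvl₀ : ∀ w ∈ W₀, G.lvl w = 2 := fun w hw => ((hW₀ w).1 hw).2.1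
  obtain ⟨t₀, ht₀⟩ := hiso h₀
  have hs2 : s ≠ 2 := by
    have := hs _ hh₀ _ ht₀
    have := hP.lvl_nbr_mid _ _ (hlvl₀ _ hh₀) ht₀
    omega
  have hmemW : ∀ w ∈ W, Reach G a w := by
    rintro w (hw | ⟨w', hw', h⟩)
    · exact ((hW₀ w).1 hw).1
    · exact ((hW₀ w').1 hw').1.tail h
  have hlvl : ∀ w ∈ W, G.lvl w ≠ 2 → G.lvl w = s := by
    rintro w (hw | ⟨w', hw', h⟩) h2
    · exact absurd (hlvl₀ w hw) h2
    · exact hs w' hw' w h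
  have hmid : ∀ w ∈ W, G.lvl w = 2 → w ∈ W₀ := by
    rintro w (hw | ⟨w', hw', h⟩) h2
    · exact hw
    · exact absurd ((hs w' hw' w h).symm.trans h2) hs2
  have houter : ∀ w ∈ W, G.lvl w ≠ 2 → ∃ q, q ∈ W₀ ∧ Adj G q w := by
    rintro w (hw | h) h2
    · exact absurd (hlvl₀ w hw) h2
    · exact h
  -- a vertex with outside neighbors has neighbors on both sides of `β`
  have hgate : ∀ w ∈ W, ∀ z, z ∉ W → Adj G w z → G.lvl w = s ∧ ∃ p q, Adj G p w ∧ Adj G q w ∧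
      G.lvl p = 2 ∧ G.lvl q = 2 ∧ x p < β ∧ β < x q := by
    intro w hw z hz hwz
    have hw2 : G.lvl w ≠ 2 := fun h => hz (Or.inr ⟨w, hmid w hw h, hwz⟩)
    obtain ⟨q, hq, hqw⟩ := houter w hw hw2
    have hz2 := hP.lvl_nbr_outer w z hw2 hwz
    have hrz := (hmemW w hw).tail hwz
    refine ⟨hlvl w hw hw2, z, q, hwz.symm, hqw, hz2, hlvl₀ q hq, ?_, ((hW₀ q).1 hq).2.2⟩
    exact lt_of_le_of_ne (not_lt.1 fun h => hz (Or.inl ((hW₀ z).2 ⟨hrz, hz2, h⟩))) (hβ z hrz hz2)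
  have huniq : ∀ w ∈ W, ∀ w' ∈ W, ∀ z z', z ∉ W → z' ∉ W → Adj G w z → Adj G w' z' →
      x w ≤ x w' := by
    intro w hw w' hw' z z' hz hz' h h'
    obtain ⟨e, p, -, hpw, -, hp2, -, hpβ, -⟩ := hgate w hw z hz h
    obtain ⟨e', -, q, -, hqw, -, hq2, -, hqβ⟩ := hgate w' hw' z' hz' h'
    exact hP.noncrossing p q w w' hp2 hq2 (e.trans e'.symm) hpw hqw (hpβ.trans hqβ)
  have hreach₀ := (hW₀ h₀).1 hh₀
  obtain ⟨c, g, d, hpc, hcg, hgd, hc, hd, hxc, hxd⟩ :=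
    hP.exists_bridging (hap.symm.trans hreach₀.1) hp hreach₀.2.1 hpβ hreach₀.2.2
      (fun w hw => hβ w (hap.trans hw))
  have hdW : d ∈ W₀ := (hW₀ d).2 ⟨hap.trans ((hpc.tail hcg).tail hgd), hd, hxd⟩
  have hgW : g ∈ W := Or.inr ⟨d, hdW, hgd.symm⟩
  have hcW : c ∉ W := fun h => hxc.not_gt ((hW₀ c).1 (hmid c h hc)).2.2
  have hpW : p ∉ W := fun h => hpβ.not_gt ((hW₀ p).1 (hmid p h hp)).2.2
  have hgu : ∀ w ∈ W, ∀ z, z ∉ W → Adj G w z → w = g := fun w hw z hz h =>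
    hP.inj w g ((hgate w hw z hz h).1.trans (hgate g hgW c hcW hcg.symm).1.symm)
      ((huniq w hw g hgW z c hz hcW h hcg.symm).antisymm
        (huniq g hgW w hw c z hcW hz hcg.symm h))
  have hadj : ∀ u v : W, (inducedSG G W).Adj u v ↔ u ≠ v ∧ Adj G u v := fun u v =>
    SimpleGraph.fromRel_adj _ u v
  have hconn_g : ∀ v, Reach G v p → ∀ hv : v ∈ W, (inducedSG G W).Reachable ⟨v, hv⟩ ⟨g, hgW⟩ := by
    intro v hvp
    induction hvp using Relation.ReflTransGen.head_induction_on with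
    | refl => exact fun hv => absurd hv hpW
    | @head v v' hvv' _ ih =>
      intro hv
      by_cases hv' : v' ∈ W
      · refine SimpleGraph.Reachable.trans ?_ (ih hv')
        by_cases he : v = v'
        · subst he
          rfl
        · exact SimpleGraph.Adj.reachable ((hadj _ _).2 ⟨fun h => he (Subtype.ext_iff.1 h), hvv'⟩)
      · obtain rfl := hgu v hv v' hv' hvv'
        rfl
  have hconn : (inducedSG G W).Connected :=
    { preconnected := fun u v => (hconn_g u ((hmemW u u.2).symm.trans hap) u.2).trans
        (hconn_g v ((hmemW v v.2).symm.trans hap) v.2).symm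
      nonempty := ⟨⟨g, hgW⟩⟩ }
  have hgs := (hgate g hgW c hcW hcg.symm).1
  refine ⟨⟨2, s, hs2.symm, ⟨d, Or.inl hdW, hd⟩, ⟨g, hgW, hgs⟩, fun v hv => ?_⟩, ?_,
    ⟨g, ⟨hgW, c, hcW, hcg.symm⟩, fun w hw => ?_⟩⟩
  · by_cases h2 : G.lvl v = 2
    · exact Or.inl h2
    · exact Or.inr (hlvl v hv h2)
  · have : Nontrivial W := ⟨⟨⟨d, Or.inl hdW⟩, ⟨g, hgW⟩, fun h => hs2 <| by
      rw [← hgs, ← hd]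
      exact congrArg G.lvl (Subtype.ext_iff.1 h).symm⟩⟩
    have hsame : ∀ u v : W, (G.lvl u = 2 ↔ G.lvl v = 2) → G.lvl u = G.lvl v := by
      intro u v huv
      by_cases hu : G.lvl u = 2
      · exact hu.trans (huv.1 hu).symm
      · exact (hlvl u u.2 hu).trans (hlvl v v.2 (mt huv.2 hu)).symm
    have hbip : ∀ u v : W, (inducedSG G W).Adj u v → (G.lvl u = 2 ↔ ¬ G.lvl v = 2) := by
      intro u v h
      have h' := ((hadj u v).1 h).2
      constructor
      · intro hu
        have := hP.lvl_nbr_mid _ _ hu h'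
        omega
      · exact fun hv => hP.lvl_nbr_outer _ _ hv h'.symm
    refine SimpleGraph.TwoLayerNoncrossing.isCaterpillar (mid := fun v : W => G.lvl v = 2)
      (x := fun v : W => x v) ⟨hbip, ?_, ?_⟩ hconn
    · exact fun u v huv h => Subtype.ext (hP.inj _ _ (hsame u v huv) h)
    · intro m m' t t' hm hm' h h' hlt
      have h1 := hbip _ _ h
      have h2 := hbip _ _ h'
      exact hP.noncrossing m m' t t' hm hm' (hsame t t' (by tauto)) ((hadj _ _).1 h).2
        ((hadj _ _).1 h').2 hlt
  · obtain ⟨hw, z, hz, h⟩ := hw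
    exact hgu w hw z hz h

end ThreeLevelPlanar

/-- properties of hook pieces.  Let `A` and `B` be distinct
connected components such that `B` hooks into `A` from the right in the
constrained level planar drawing `D` of a proper constrained level graph of
height 3 without isolated vertices.  Then (1) both hook pieces occupy exactly
two levels and are caterpillars; (2) each hook piece contains exactly one
vertex with a neighbor outside of it; (3) all neighbors of the hook vertices
of `A` towards `B` lie on a common level, likewise for `B` towards `A`;
(4) if the former common level is the top level then the latter is the bottom
level and vice versa. -/
theorem hook_piece_properties (G : ConstrainedLevelGraph V)
    (hh : G.h = 3)
    (hproper : ∀ u v, G.Edge u v → G.lvl v = G.lvl u + 1)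
    (hiso : ∀ v : V, ∃ u, Adj G v u)
    (D : CLPDrawing G) (a b : V) (hab : ¬ Reach G a b)
    (A : Set V) (B : Set V) (hA : A = {v | Reach G a v}) (hB : B = {v | Reach G b v})
    (hhook : HooksRight G D A B) :
    (TwoLevels G (HookPiece G D A B) ∧ IsCaterpillar (inducedSG G (HookPiece G D A B)) ∧
      TwoLevels G (HookPiece G D B A) ∧ IsCaterpillar (inducedSG G (HookPiece G D B A))) ∧
    ((∃! w, w ∈ HookPiece G D A B ∧ ∃ z, z ∉ HookPiece G D A B ∧ Adj G w z) ∧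
      (∃! w, w ∈ HookPiece G D B A ∧ ∃ z, z ∉ HookPiece G D B A ∧ Adj G w z)) ∧
    ((∃ l, ∀ w ∈ HookVerts G D A B, ∀ z, Adj G w z → G.lvl z = l) ∧
      (∃ l, ∀ w ∈ HookVerts G D B A, ∀ z, Adj G w z → G.lvl z = l)) ∧
    (((∀ w ∈ HookVerts G D A B, ∀ z, Adj G w z → G.lvl z = 3) →
        (∀ w ∈ HookVerts G D B A, ∀ z, Adj G w z → G.lvl z = 1)) ∧
      ((∀ w ∈ HookVerts G D A B, ∀ z, Adj G w z → G.lvl z = 1) →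
        (∀ w ∈ HookVerts G D B A, ∀ z, Adj G w z → G.lvl z = 3))) := by
  have hP := D.threeLevelPlanar hh hproper
  subst hA hB
  obtain ⟨u, v, u', v', hu, hv, hu', hv', -, -, hu2, hv2, hu'2, hv'2, h1, h2, h3, hmin, hmax⟩ :=
    hhook
  simp only [Set.mem_ofPred_eq] at hu hv hu' hv'
  have hba : ∀ {y z}, Reach G a y → Reach G b z → ¬ Reach G y z := fun hy hz h =>
    hab ((hy.trans h).trans hz.symm)
  obtain ⟨β, ⟨hβ, hβ2⟩, hβmin⟩ := Set.exists_min_image {w | Reach G b w ∧ G.lvl w = 2} D.x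
    (Set.toFinite _) ⟨u', hu', hu'2⟩
  obtain ⟨α, ⟨hα, hα2⟩, hαmax⟩ := Set.exists_max_image {w | Reach G a w ∧ G.lvl w = 2} D.x
    (Set.toFinite _) ⟨v, hv, hv2⟩
  have hβu' := hβmin u' ⟨hu', hu'2⟩
  have hαv := hαmax v ⟨hv, hv2⟩
  have hne : ∀ {y z}, Reach G a y → Reach G b z → G.lvl y = 2 → G.lvl z = 2 → D.x y ≠ D.x z :=
    fun hy hz hy2 hz2 h => hba hy hz (by
      rw [hP.inj _ _ (hy2.trans hz2.symm) h]
      exact Relation.ReflTransGen.refl)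
  have huβ : D.x u < D.x β := (hmin β (Or.inr hβ) hβ2).lt_of_ne (hne hu hβ hu2 hβ2)
  have hαv' : D.x α < D.x v' := (hmax α (Or.inl hα) hα2).lt_of_ne (hne hα hv' hα2 hv'2)
  have hookA : ∀ w, w ∈ HookVerts G D {v | Reach G a v} {v | Reach G b v} ↔
      Reach G a w ∧ G.lvl w = 2 ∧ D.x β < D.x w := by
    intro w
    constructor
    · rintro ⟨hw, hw2, y, hy, -, -, hy2, -, hyw, -⟩
      exact ⟨hw, hw2, ((hβmin y ⟨hy, hy2⟩).trans hyw).lt_of_ne (hne hw hβ hw2 hβ2).symm⟩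
    · rintro ⟨hw, hw2, h⟩
      exact ⟨hw, hw2, β, hβ, v', hv', hβ2, hv'2, h.le, hmax w (Or.inl hw) hw2⟩
  have hookB : ∀ w, w ∈ HookVerts G D {v | Reach G b v} {v | Reach G a v} ↔
      Reach G b w ∧ G.lvl w = 2 ∧ -D.x α < -D.x w := by
    intro w
    simp only [neg_lt_neg_iff]
    constructor
    · rintro ⟨hw, hw2, -, -, y, hy, -, hy2, -, hyw⟩
      exact ⟨hw, hw2, (hyw.trans (hαmax y ⟨hy, hy2⟩)).lt_of_ne (hne hα hw hα2 hw2).symm⟩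
    · rintro ⟨hw, hw2, h⟩
      exact ⟨hw, hw2, u, hu, α, hα, hu2, hα2, hmin w (Or.inr hw) hw2, h.le⟩
  have hαA := (hookA α).2 ⟨hα, hα2, by linarith⟩
  have hβB := (hookB β).2 ⟨hβ, hβ2, by linarith⟩
  have opp : ∀ y z s t, Reach G a y → G.lvl y = 2 → Reach G b z → G.lvl z = 2 →
      D.x z < D.x y → D.x β ≤ D.x z → D.x y ≤ D.x α → Adj G y s → Adj G z t →
      G.lvl t ≠ G.lvl s := fun y z s t hy hy2 hz hz2 hlt hl hr hs ht =>
    hP.lvl_ne_of_alternating hu2 hz2 hy2 hv'2 (hu.symm.trans hy) (hz.symm.trans hv')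
      (hba hu hz) (by linarith) hlt (by linarith) ht hs
  obtain ⟨s, hs⟩ := hiso α
  obtain ⟨t, ht⟩ := hiso β
  have hts := opp α β s t hα hα2 hβ hβ2 (by linarith) le_rfl le_rfl hs ht
  have hs13 := hP.lvl_nbr_mid _ _ hα2 hs
  have ht13 := hP.lvl_nbr_mid _ _ hβ2 ht
  have nbrA : ∀ w ∈ HookVerts G D {v | Reach G a v} {v | Reach G b v}, ∀ z, Adj G w z →
      G.lvl z = G.lvl s := by
    intro w hw z hz
    obtain ⟨hw, hw2, h⟩ := (hookA w).1 hw
    have := opp w β z t hw hw2 hβ hβ2 h le_rfl (hαmax w ⟨hw, hw2⟩) hz ht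
    have := hP.lvl_nbr_mid _ _ hw2 hz
    omega
  have nbrB : ∀ w ∈ HookVerts G D {v | Reach G b v} {v | Reach G a v}, ∀ z, Adj G w z →
      G.lvl z = G.lvl t := by
    intro w hw z hz
    obtain ⟨hw, hw2, h⟩ := (hookB w).1 hw
    have := opp α w s z hα hα2 hw hw2 (neg_lt_neg_iff.1 h) (hβmin w ⟨hw, hw2⟩) le_rfl hs hz
    have := hP.lvl_nbr_mid _ _ hw2 hz
    omega
  obtain ⟨a1, a2, a3⟩ := hP.caterpillar_right_of hiso hookA nbrA hu hu2 huβ hαA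
    (fun w hw hw2 => hne hw hβ hw2 hβ2)
  obtain ⟨b1, b2, b3⟩ := hP.neg.caterpillar_right_of hiso hookB nbrB hv' hv'2
    (neg_lt_neg hαv') hβB (fun w hw hw2 h => hne hα hw hα2 hw2 (neg_injective h).symm)
  refine ⟨⟨a1, a2, b1, b2⟩, ⟨a3, b3⟩, ⟨⟨_, nbrA⟩, ⟨_, nbrB⟩⟩, ?_, ?_⟩
  · intro h w hw z hz
    have := h α hαA s hs
    have := nbrB w hw z hz
    omega
  · intro h w hw z hz
    have := h α hαA s hs
    have := nbrB w hw z hz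
    omega
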